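/- arXiv:1905.12782 — 3 statements merged into one kernel-verified Lean document; each statement's English description precedes it below -/
import Mathlib

section
/- Let ℒ be a finite labeled set in ℝ×{−1,+1} with distinct first coordinates whose two smallest labeled points carry equal labels and whose two largest labeled points carry equal labels. Let x₁ < x₂ be consecutive labeled points with opposite labels (y₁ ≠ y₂), and let x₅ < x₆ be consecutive labeled points with equal labels (y₅ = y₆), all four lying strictly between the outermost labeled points. Then for every u with x₁ < u < x₂ and every v with x₅ < v < x₆, score_F(v) ≤ score_F(u). -/
open Matrix MeasureTheory

/-- A two-layer ReLU network with `N` hidden units: `x ↦ ∑ n, v n * max 0 (u n * x + b n) + c`. -/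
noncomputable def reluNet (N : ℕ) (v u b : Fin N → ℝ) (c : ℝ) : ℝ → ℝ :=
  fun x => (∑ n, v n * max 0 (u n * x + b n)) + c

/-- The Euclidean norm of the weight vector `w = (v, u)` of a two-layer ReLU network. -/
noncomputable def weightNorm (N : ℕ) (v u : Fin N → ℝ) : ℝ :=
  Real.sqrt ((∑ n, (v n) ^ 2) + (∑ n, (u n) ^ 2))

/-- The minimum interpolation "norm" `m(ℒ)` of a finite labeled set `ℒ`. -/
noncomputable def interpNorm (L : Finset (ℝ × ℝ)) : ℝ :=
  sInf {t : ℝ | ∃ (N : ℕ) (v u b : Fin N → ℝ) (c : ℝ),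
    (∀ q ∈ L, reluNet N v u b c q.1 = q.2) ∧ t = weightNorm N v u}

/-- The function-norm score: `score_F(x) = min (m(ℒ ∪ {(x,+1)}), m(ℒ ∪ {(x,−1)}))`. -/
noncomputable def scoreF (L : Finset (ℝ × ℝ)) (x : ℝ) : ℝ :=
  min (interpNorm (insert (x, 1) L)) (interpNorm (insert (x, -1) L))

/-- The labeled points have distinct first coordinates. -/
def distinctX (L : Finset (ℝ × ℝ)) : Prop := ∀ p ∈ L, ∀ q ∈ L, p.1 = q.1 → p = q

/-- All labels are in {−1, +1}. -/
def labelsPM (L : Finset (ℝ × ℝ)) : Prop := ∀ p ∈ L, p.2 = 1 ∨ p.2 = -1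

/-- The two smallest labeled points carry equal labels. -/
def twoSmallestEqual (L : Finset (ℝ × ℝ)) : Prop :=
  ∃ p ∈ L, ∃ q ∈ L, p.1 < q.1 ∧ (∀ r ∈ L, r ≠ p → r ≠ q → q.1 < r.1) ∧ p.2 = q.2

/-- The two largest labeled points carry equal labels. -/
def twoLargestEqual (L : Finset (ℝ × ℝ)) : Prop :=
  ∃ p ∈ L, ∃ q ∈ L, q.1 < p.1 ∧ (∀ r ∈ L, r ≠ p → r ≠ q → r.1 < q.1) ∧ p.2 = q.2

/-- The point lies strictly between the outermost labeled points of `L`. -/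
def strictlyInterior (L : Finset (ℝ × ℝ)) (t : ℝ) : Prop :=
  (∃ a ∈ L, a.1 < t) ∧ (∃ b ∈ L, t < b.1)

theorem bddBelow_interpolatingNorms (L : Finset (ℝ × ℝ)) :
    BddBelow {t : ℝ | ∃ (N : ℕ) (v u b : Fin N → ℝ) (c : ℝ),
      (∀ q ∈ L, reluNet N v u b c q.1 = q.2) ∧ t = weightNorm N v u} := by
  refine ⟨0, ?_⟩
  rintro t ⟨N, v, u, b, c, -, rfl⟩
  exact Real.sqrt_nonneg _

/-- Every finite set of points with distinct first coordinates is interpolated by a network. -/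
theorem exists_reluNet_interpolating (L : Finset (ℝ × ℝ)) (hL : distinctX L) :
    ∃ (N : ℕ) (v u b : Fin N → ℝ) (c : ℝ), ∀ q ∈ L, reluNet N v u b c q.1 = q.2 := by
  induction L using Finset.induction_on_max_value (Prod.fst : ℝ × ℝ → ℝ) with
  | empty => exact ⟨0, 0, 0, 0, 0, by simp⟩
  | insert a s has hmax ih =>
    obtain ⟨N, v, u, b, c, h⟩ := ih fun p hp q hq =>
      hL p (Finset.mem_insert_of_mem hp) q (Finset.mem_insert_of_mem hq)
    have hlt : ∀ r ∈ s, r.1 < a.1 := fun r hr =>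
      lt_of_le_of_ne (hmax r hr) fun he => has <| by
        rw [← hL r (Finset.mem_insert_of_mem hr) a (Finset.mem_insert_self a s) he]
        exact hr
    obtain ⟨M, hM, hMa⟩ : ∃ M, (∀ r ∈ s, r.1 ≤ M) ∧ M < a.1 := by
      rcases s.eq_empty_or_nonempty with rfl | hs
      · exact ⟨a.1 - 1, by simp, by linarith⟩
      · obtain ⟨r, hr, hr'⟩ := s.exists_max_image Prod.fst hs
        exact ⟨r.1, hr', hlt r hr⟩
    refine ⟨N + 1, Fin.cons ((a.2 - reluNet N v u b c a.1) / (a.1 - M)) v, Fin.cons 1 u,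
      Fin.cons (-M) b, c, ?_⟩
    have key : ∀ k x : ℝ, reluNet (N + 1) (Fin.cons k v) (Fin.cons 1 u) (Fin.cons (-M) b) c x =
        k * max 0 (x - M) + reluNet N v u b c x := by
      intro k x
      simp only [reluNet, Fin.sum_univ_succ, Fin.cons_zero, Fin.cons_succ]
      ring_nf
    intro q hq
    rw [key]
    rcases Finset.mem_insert.1 hq with rfl | hq
    · have : q.1 - M ≠ 0 := (sub_pos.2 hMa).ne'
      rw [max_eq_right (sub_pos.2 hMa).le]
      field_simp
      ring
    · rw [max_eq_left (sub_nonpos.2 (hM q hq)), h q hq]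
      ring

/-- Linear interpolation of a single neuron between `p` and `q` is a sum of two neurons with the
same total squared weight. -/
theorem exists_neurons_interpolating_on_Icc (v u b : ℝ) {p q w : ℝ} (hpw : p < w) (hwq : w < q) :
    ∃ v₁ u₁ b₁ v₂ u₂ b₂ : ℝ, v₁ ^ 2 + v₂ ^ 2 + (u₁ ^ 2 + u₂ ^ 2) = v ^ 2 + u ^ 2 ∧
      (∀ x, ¬(p < x ∧ x < q) →
        v₁ * max 0 (u₁ * x + b₁) + v₂ * max 0 (u₂ * x + b₂) = v * max 0 (u * x + b)) ∧
      (q - p) * (v₁ * max 0 (u₁ * w + b₁) + v₂ * max 0 (u₂ * w + b₂)) =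
        (q - w) * (v * max 0 (u * p + b)) + (w - p) * (v * max 0 (u * q + b)) := by
  have hqp : 0 < q - p := by linarith
  have hw : (q - p) * (u * w + b) = (q - w) * (u * p + b) + (w - p) * (u * q + b) := by ring
  by_cases hsign : (u * p + b) * (u * q + b) < 0
  · have hu : u ≠ 0 := by
      rintro rfl
      nlinarith [sq_nonneg b]
    obtain ⟨α, hα⟩ : ∃ α, α * (u * (q - p)) = u * q + b :=
      ⟨(u * q + b) / (u * (q - p)), div_mul_cancel₀ _ (mul_ne_zero hu hqp.ne')⟩
    have hα' : (1 - α) * (u * (q - p)) = -(u * p + b) := by linear_combination -hα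
    have hb : b = -α * u * p - (1 - α) * u * q := by linear_combination -hα
    have hprod : 0 < α * (1 - α) := by
      have h : 0 < α * (1 - α) * (u * (q - p)) ^ 2 := by
        have : α * (1 - α) * (u * (q - p)) ^ 2 = -((u * p + b) * (u * q + b)) := by
          rw [sq, mul_mul_mul_comm, hα, hα']; ring
        linarith
      exact pos_of_mul_pos_left h (sq_nonneg _)
    have hα0 : 0 ≤ α := by nlinarith
    have hα1 : 0 ≤ 1 - α := by nlinarith
    have scale : ∀ β : ℝ, 0 ≤ β → ∀ z x : ℝ,
        √β * v * max 0 (√β * u * x + -(√β * u * z)) = β * (v * max 0 (u * (x - z))) := by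
      intro β hβ z x
      have : √β * u * x + -(√β * u * z) = √β * (u * (x - z)) := by ring
      rw [this, ← mul_zero √β, ← mul_max_of_nonneg _ _ (Real.sqrt_nonneg β), mul_zero]
      linear_combination (v * max 0 (u * (x - z))) * Real.mul_self_sqrt hβ
    refine ⟨√α * v, √α * u, -(√α * u * p), √(1 - α) * v, √(1 - α) * u, -(√(1 - α) * u * q),
      ?_, ?_, ?_⟩
    · simp only [mul_pow, Real.sq_sqrt hα0, Real.sq_sqrt hα1]
      ring
    · intro x hx
      rw [scale α hα0, scale (1 - α) hα1]
      have hsplit : u * x + b = α * (u * (x - p)) + (1 - α) * (u * (x - q)) := by rw [hb]; ring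
      have hsame : (0 ≤ u * (x - p) ∧ 0 ≤ u * (x - q)) ∨ (u * (x - p) ≤ 0 ∧ u * (x - q) ≤ 0) := by
        have hx' : x ≤ p ∨ q ≤ x := by
          by_contra! h
          exact hx h
        rcases hx' with hx' | hx' <;> rcases le_total 0 u with h0 | h0
        · right; constructor <;> nlinarith
        · left; constructor <;> nlinarith
        · left; constructor <;> nlinarith
        · right; constructor <;> nlinarith
      rcases hsame with ⟨h₁, h₂⟩ | ⟨h₁, h₂⟩
      · rw [max_eq_right h₁, max_eq_right h₂, max_eq_right (by rw [hsplit]; positivity), hsplit]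
        ring
      · rw [max_eq_left h₁, max_eq_left h₂, max_eq_left (by rw [hsplit]; nlinarith)]
        ring
    · rw [scale α hα0, scale (1 - α) hα1]
      rcases hu.lt_or_gt with h0 | h0
      · have hD : u * (q - p) ≤ 0 := (mul_neg_of_neg_of_pos h0 hqp).le
        have hp := mul_nonpos_of_nonneg_of_nonpos hα1 hD
        have hq := mul_nonpos_of_nonneg_of_nonpos hα0 hD
        rw [max_eq_left (show u * (w - p) ≤ 0 by nlinarith),
          max_eq_right (show 0 ≤ u * (w - q) by nlinarith),
          max_eq_right (show 0 ≤ u * p + b by linarith),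
          max_eq_left (show u * q + b ≤ 0 by linarith)]
        linear_combination v * (w - q) * hα'
      · have hD : 0 ≤ u * (q - p) := (mul_pos h0 hqp).le
        have hp := mul_nonneg hα1 hD
        have hq := mul_nonneg hα0 hD
        rw [max_eq_right (show 0 ≤ u * (w - p) by nlinarith),
          max_eq_left (show u * (w - q) ≤ 0 by nlinarith),
          max_eq_left (show u * p + b ≤ 0 by linarith),
          max_eq_right (show 0 ≤ u * q + b by linarith)]
        linear_combination v * (w - p) * hα
  · refine ⟨v, u, b, 0, 0, 0, by ring, fun x _ => by ring, ?_⟩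
    rcases mul_nonneg_iff.1 (not_lt.1 hsign) with ⟨h₁, h₂⟩ | ⟨h₁, h₂⟩
    · rw [max_eq_right h₁, max_eq_right h₂, max_eq_right (by nlinarith)]
      ring
    · rw [max_eq_left h₁, max_eq_left h₂, max_eq_left (by nlinarith)]
      ring

/-- A network can be made linear between `p` and `q` without changing its weight norm or its values
outside of this interval. -/
theorem exists_reluNet_interpolating_on_Icc (N : ℕ) (v u b : Fin N → ℝ) (c : ℝ) {p q w : ℝ}
    (hpw : p < w) (hwq : w < q) :
    ∃ v' u' b' : Fin (N + N) → ℝ, weightNorm (N + N) v' u' = weightNorm N v u ∧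
      (∀ x, ¬(p < x ∧ x < q) → reluNet (N + N) v' u' b' c x = reluNet N v u b c x) ∧
      (q - p) * reluNet (N + N) v' u' b' c w =
        (q - w) * reluNet N v u b c p + (w - p) * reluNet N v u b c q := by
  choose v₁ u₁ b₁ v₂ u₂ b₂ hnorm hout hin using fun n =>
    exists_neurons_interpolating_on_Icc (v n) (u n) (b n) hpw hwq
  refine ⟨Fin.append v₁ v₂, Fin.append u₁ u₂, Fin.append b₁ b₂, ?_, fun x hx => ?_, ?_⟩
  · simp only [weightNorm, Fin.sum_univ_add, Fin.append_left, Fin.append_right,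
      ← Finset.sum_add_distrib, hnorm]
  · simp only [reluNet, Fin.sum_univ_add, Fin.append_left, Fin.append_right,
      ← Finset.sum_add_distrib, hout _ x hx]
  · have hsum := Finset.sum_congr (rfl : (Finset.univ : Finset (Fin N)) = _) fun n _ => hin n
    simp only [← Finset.mul_sum, Finset.sum_add_distrib] at hsum
    simp only [reluNet, Fin.sum_univ_add, Fin.append_left, Fin.append_right]
    linear_combination hsum

/-- Labeling a point between two consecutive points of equal label by that label does not increase
the minimum interpolation norm. -/
theorem interpNorm_insert_le {L : Finset (ℝ × ℝ)} (hL : distinctX L) {p q y w : ℝ}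
    (hp : (p, y) ∈ L) (hq : (q, y) ∈ L) (hcons : ∀ r ∈ L, ¬(p < r.1 ∧ r.1 < q))
    (hpw : p < w) (hwq : w < q) :
    interpNorm (insert (w, y) L) ≤ interpNorm L := by
  obtain ⟨N, v, u, b, c, h⟩ := exists_reluNet_interpolating L hL
  refine le_csInf ⟨_, N, v, u, b, c, h, rfl⟩ ?_
  rintro t ⟨N, v, u, b, c, h, rfl⟩
  obtain ⟨v', u', b', hnorm, hout, hin⟩ := exists_reluNet_interpolating_on_Icc N v u b c hpw hwq
  refine csInf_le (bddBelow_interpolatingNorms _) ⟨N + N, v', u', b', c, ?_, hnorm.symm⟩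
  intro r hr
  rcases Finset.mem_insert.1 hr with rfl | hr
  · rw [h _ hp, h _ hq] at hin
    have hqp : q - p ≠ 0 := by linarith
    exact mul_left_cancel₀ hqp (by linear_combination hin)
  · rw [hout _ (hcons r hr), h r hr]

/-- Labeling a further point does not decrease the minimum interpolation norm. -/
theorem interpNorm_le_insert {L : Finset (ℝ × ℝ)} (hL : distinctX L) {w : ℝ}
    (hw : ∀ r ∈ L, r.1 ≠ w) (y : ℝ) : interpNorm L ≤ interpNorm (insert (w, y) L) := by
  have hL' : distinctX (insert (w, y) L) := by
    intro p hp q hq hpq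
    rcases Finset.mem_insert.1 hp with rfl | hp <;> rcases Finset.mem_insert.1 hq with rfl | hq
    · rfl
    · exact absurd hpq.symm (hw q hq)
    · exact absurd hpq (hw p hp)
    · exact hL p hp q hq hpq
  obtain ⟨N, v, u, b, c, h⟩ := exists_reluNet_interpolating _ hL'
  refine csInf_le_csInf (bddBelow_interpolatingNorms L) ⟨_, N, v, u, b, c, h, rfl⟩ ?_
  rintro t ⟨N, v, u, b, c, h, ht⟩
  exact ⟨N, v, u, b, c, fun q hq => h q (Finset.mem_insert_of_mem hq), ht⟩


/-- If `x₁ < x₂` are consecutive labeled points of `ℒ` with opposite labels and `x₅ < x₆` are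
consecutive labeled points with equal labels, all strictly between the outermost labeled
points, then every point between `x₅` and `x₆` scores at most every point between
`x₁` and `x₂`. -/
theorem maximin_reluNet_opposite_beats_same (L : Finset (ℝ × ℝ))
    (hdx : distinctX L) (hlab : labelsPM L)
    (hsmall : twoSmallestEqual L) (hlarge : twoLargestEqual L)
    (x₁ x₂ y₁ y₂ x₅ x₆ y₅ y₆ : ℝ)
    (h₁ : (x₁, y₁) ∈ L) (h₂ : (x₂, y₂) ∈ L) (h12 : x₁ < x₂)
    (h₅ : (x₅, y₅) ∈ L) (h₆ : (x₆, y₆) ∈ L) (h56 : x₅ < x₆)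
    (hcons12 : ∀ r ∈ L, ¬(x₁ < r.1 ∧ r.1 < x₂))
    (hcons56 : ∀ r ∈ L, ¬(x₅ < r.1 ∧ r.1 < x₆))
    (hint₁ : strictlyInterior L x₁) (hint₂ : strictlyInterior L x₂)
    (hint₅ : strictlyInterior L x₅) (hint₆ : strictlyInterior L x₆)
    (hy12 : y₁ ≠ y₂) (hy56 : y₅ = y₆) :
    ∀ u : ℝ, x₁ < u → u < x₂ → ∀ v : ℝ, x₅ < v → v < x₆ →
      scoreF L v ≤ scoreF L u := by
  intro u hu₁ hu₂ v hv₅ hv₆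
  subst hy56
  have hu : ∀ r ∈ L, r.1 ≠ u := by
    rintro r hr rfl
    exact hcons12 r hr ⟨hu₁, hu₂⟩
  have hle := interpNorm_insert_le hdx h₅ h₆ hcons56 hv₅ hv₆
  refine le_trans ?_ (le_min (interpNorm_le_insert hdx hu 1) (interpNorm_le_insert hdx hu (-1)))
  rcases hlab _ h₅ with rfl | rfl
  · exact (min_le_left _ _).trans hle
  · exact (min_le_right _ _).trans hle
end

section
/- Let (x₁,y₁),…,(x_M,y_M) be data with distinct real x_i. Then the infimum, over all N ≥ M and over all two-layer ReLU network parameters (w,b,c) with f_{w,b,c}(x_i) = y_i for i = 1,…,M, of the weight norm ‖w‖₂ is attained by a network whose function agrees on the interval [min_i x_i, max_i x_i] with the minimal-knot linear spline interpolant of the data, i.e., with the piecewise linear function that connects each pair of consecutive data points by an affine segment. -/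
/-- The slope of the segment from `(X k, Y k)` to `(X (k + 1), Y (k + 1))`. -/
noncomputable def segmentSlope (X Y : ℕ → ℝ) (k : ℕ) : ℝ :=
  (Y (k + 1) - Y k) / (X (k + 1) - X k)

/-- The total variation of the first `n + 1` segment slopes. -/
noncomputable def slopeVariation (n : ℕ) (X Y : ℕ → ℝ) : ℝ :=
  ∑ k ∈ Finset.range n, |segmentSlope X Y (k + 1) - segmentSlope X Y k|

theorem exists_abs_add_mul_eq_max (K T : ℝ) (hT : 0 ≤ T) :
    ∃ η : ℝ, |η| ≤ 1 ∧ |K + η * T| = max 0 (|K| - T) := by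
  rcases le_total |K| T with h | h
  · rcases hT.eq_or_lt with rfl | hT
    · exact ⟨0, by simp, by simp [abs_nonpos_iff.1 h]⟩
    · refine ⟨-K / T, ?_, ?_⟩
      · rw [abs_div, abs_neg, abs_of_pos hT]
        exact (div_le_one hT).2 h
      · rw [div_mul_cancel₀ _ hT.ne', max_eq_left (by linarith)]
        simp
  · rw [max_eq_right (by linarith)]
    rcases le_total 0 K with hK | hK
    · rw [abs_of_nonneg hK] at h ⊢
      exact ⟨-1, by simp, by rw [abs_of_nonneg] <;> linarith⟩
    · rw [abs_of_nonpos hK] at h ⊢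
      exact ⟨1, by simp, by rw [abs_of_nonpos] <;> linarith⟩

theorem abs_half_add_mul_abs (d η : ℝ) (hη : |η| ≤ 1) :
    |(d + η * |d|) / 2| + |(d - η * |d|) / 2| = |d| := by
  obtain ⟨h₁, h₂⟩ := abs_le.1 hη
  rcases le_total 0 d with hd | hd
  · rw [abs_of_nonneg hd, abs_of_nonneg, abs_of_nonneg] <;> nlinarith
  · rw [abs_of_nonpos hd, abs_of_nonpos, abs_of_nonpos] <;> nlinarith

/-- A weighted sum of ReLU units with unit inner weights is realised by a balanced network. -/
theorem exists_balanced_reluNet {ι : Type*} [Fintype ι] (a ε τ : ι → ℝ)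
    (hε : ∀ i, ε i ^ 2 = 1) :
    ∃ v u b : Fin (Fintype.card ι) → ℝ,
      (∀ c t, reluNet (Fintype.card ι) v u b c t =
        ∑ i, a i * max 0 (ε i * (t - τ i)) + c) ∧
      weightNorm (Fintype.card ι) v u = Real.sqrt (2 * ∑ i, |a i|) := by
  let e := (Fintype.equivFin ι).symm
  have hs (i : ι) : √|a i| * √|a i| = |a i| := Real.mul_self_sqrt (abs_nonneg _)
  refine ⟨fun k => SignType.sign (a (e k)) * √|a (e k)|, fun k => ε (e k) * √|a (e k)|,
    fun k => -(ε (e k) * √|a (e k)| * τ (e k)), fun c t => ?_, ?_⟩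
  · unfold reluNet
    rw [← e.sum_comp]
    congr 1
    refine Finset.sum_congr rfl fun k _ => ?_
    have h : ε (e k) * √|a (e k)| * t + -(ε (e k) * √|a (e k)| * τ (e k)) =
        √|a (e k)| * (ε (e k) * (t - τ (e k))) := by ring
    have h' : max 0 (√|a (e k)| * (ε (e k) * (t - τ (e k)))) =
        √|a (e k)| * max 0 (ε (e k) * (t - τ (e k))) := by
      rw [mul_max_of_nonneg _ _ (Real.sqrt_nonneg _), mul_zero]
    rw [h, h']
    conv_rhs => rw [← sign_mul_abs (a (e k)), ← hs]
    ring
  · unfold weightNorm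
    rw [← e.sum_comp, ← Finset.sum_add_distrib, Finset.mul_sum]
    congr 1
    refine Finset.sum_congr rfl fun k _ => ?_
    have h₁ : ((SignType.sign (a (e k)) : ℝ) * √|a (e k)|) ^ 2 = |a (e k)| := by
      rcases eq_or_ne (a (e k)) 0 with h | h
      · simp [h]
      · have hsign : ((SignType.sign (a (e k)) : ℝ)) ^ 2 = 1 := by
          rcases h.lt_or_gt with h | h <;> simp [h]
        rw [mul_pow, hsign, one_mul, pow_two, hs]
    have h₂ : (ε (e k) * √|a (e k)|) ^ 2 = |a (e k)| := by
      rw [mul_pow, hε, one_mul, pow_two, hs]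
    rw [h₁, h₂]
    ring

theorem segmentSlope_relu_mono (X : ℕ → ℝ) (u b : ℝ) (k : ℕ) (h₀ : X k < X (k + 1))
    (h₁ : X (k + 1) < X (k + 2)) :
    segmentSlope X (fun j => max 0 (u * X j + b)) k ≤
      segmentSlope X (fun j => max 0 (u * X j + b)) (k + 1) := by
  have hc : ConvexOn ℝ Set.univ fun t : ℝ => max 0 (u * t + b) := by
    refine (convexOn_const 0 convex_univ).sup ⟨convex_univ, fun p _ q _ s r _ _ hsr => ?_⟩
    simp only [smul_eq_mul]
    apply le_of_eq
    linear_combination (-b) * hsr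
  exact hc.slope_mono_adjacent (Set.mem_univ _) (Set.mem_univ _) h₀ h₁

theorem segmentSlope_relu_mem (X : ℕ → ℝ) (u b : ℝ) (k : ℕ) (h : X k < X (k + 1)) :
    min 0 u ≤ segmentSlope X (fun j => max 0 (u * X j + b)) k ∧
      segmentSlope X (fun j => max 0 (u * X j + b)) k ≤ max 0 u := by
  have hd : 0 < X (k + 1) - X k := by linarith
  unfold segmentSlope
  rw [le_div_iff₀ hd, div_le_iff₀ hd]
  rcases le_total 0 u with hu | hu
  · have := mul_nonneg hu hd.le
    rw [min_eq_left hu, max_eq_right hu]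
    rcases max_cases 0 (u * X k + b) with h₁ | h₁ <;>
    rcases max_cases 0 (u * X (k + 1) + b) with h₂ | h₂ <;>
    constructor <;> nlinarith
  · have := mul_nonneg (neg_nonneg.2 hu) hd.le
    rw [min_eq_right hu, max_eq_left hu]
    rcases max_cases 0 (u * X k + b) with h₁ | h₁ <;>
    rcases max_cases 0 (u * X (k + 1) + b) with h₂ | h₂ <;>
    constructor <;> nlinarith

theorem slopeVariation_relu_le (n : ℕ) (X : ℕ → ℝ) (hX : ∀ k ≤ n, X k < X (k + 1))
    (u b : ℝ) :
    slopeVariation n X (fun j => max 0 (u * X j + b)) ≤ |u| ∧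
      slopeVariation n X (fun j => max 0 (u * X j + b)) +
        |segmentSlope X (fun j => max 0 (u * X j + b)) 0 +
          segmentSlope X (fun j => max 0 (u * X j + b)) n| ≤ 2 * |u| := by
  set Y : ℕ → ℝ := fun j => max 0 (u * X j + b) with hY
  have hT : slopeVariation n X Y = segmentSlope X Y n - segmentSlope X Y 0 := by
    rw [← Finset.sum_range_sub, slopeVariation]
    refine Finset.sum_congr rfl fun k hk => abs_of_nonneg (sub_nonneg.2 ?_)
    have := Finset.mem_range.1 hk
    exact segmentSlope_relu_mono X u b k (hX k (by omega)) (hX (k + 1) (by omega))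
  obtain ⟨h₁, h₂⟩ := segmentSlope_relu_mem X u b 0 (hX 0 (by omega))
  obtain ⟨h₃, h₄⟩ := segmentSlope_relu_mem X u b n (hX n le_rfl)
  rw [← hY] at h₁ h₂ h₃ h₄
  rcases le_total 0 u with hu | hu
  · rw [min_eq_left hu] at h₁ h₃
    rw [max_eq_right hu] at h₂ h₄
    rw [abs_of_nonneg hu, abs_of_nonneg (add_nonneg h₁ h₃)]
    constructor <;> linarith
  · rw [min_eq_right hu] at h₁ h₃
    rw [max_eq_left hu] at h₂ h₄
    rw [abs_of_nonpos hu, abs_of_nonpos (add_nonpos h₂ h₄)]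
    constructor <;> linarith

theorem segmentSlope_reluNet (X : ℕ → ℝ) (N : ℕ) (v u b : Fin N → ℝ) (c : ℝ) (k : ℕ) :
    segmentSlope X (fun j => reluNet N v u b c (X j)) k =
      ∑ i, v i * segmentSlope X (fun j => max 0 (u i * X j + b i)) k := by
  simp only [segmentSlope, reluNet, mul_div_assoc', ← Finset.sum_div, mul_sub,
    Finset.sum_sub_distrib]
  ring

theorem slopeVariation_reluNet_le (X : ℕ → ℝ) (n N : ℕ) (v u b : Fin N → ℝ) (c : ℝ) :
    slopeVariation n X (fun j => reluNet N v u b c (X j)) ≤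
      ∑ i, |v i| * slopeVariation n X (fun j => max 0 (u i * X j + b i)) := by
  simp only [slopeVariation, Finset.mul_sum]
  rw [Finset.sum_comm]
  refine Finset.sum_le_sum fun k _ => ?_
  simp only [segmentSlope_reluNet, ← Finset.sum_sub_distrib, ← mul_sub, ← abs_mul]
  exact Finset.abs_sum_le_sum_abs _ _

/-- The slopes of an interpolated data set bound the weights of the network from below. -/
theorem slope_bounds_le_sum_sq (n : ℕ) (X : ℕ → ℝ) (hX : ∀ k ≤ n, X k < X (k + 1))
    (N : ℕ) (v u b : Fin N → ℝ) (c : ℝ) :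
    2 * slopeVariation n X (fun j => reluNet N v u b c (X j)) ≤
        ∑ i, v i ^ 2 + ∑ i, u i ^ 2 ∧
      slopeVariation n X (fun j => reluNet N v u b c (X j)) +
        |segmentSlope X (fun j => reluNet N v u b c (X j)) 0 +
          segmentSlope X (fun j => reluNet N v u b c (X j)) n| ≤
        ∑ i, v i ^ 2 + ∑ i, u i ^ 2 := by
  have hvar := slopeVariation_reluNet_le X n N v u b c
  have hends : |segmentSlope X (fun j => reluNet N v u b c (X j)) 0 +
      segmentSlope X (fun j => reluNet N v u b c (X j)) n| ≤
      ∑ i, |v i| * |segmentSlope X (fun j => max 0 (u i * X j + b i)) 0 +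
        segmentSlope X (fun j => max 0 (u i * X j + b i)) n| := by
    simp only [segmentSlope_reluNet, ← Finset.sum_add_distrib, ← mul_add, ← abs_mul]
    exact Finset.abs_sum_le_sum_abs _ _
  have hprod : ∑ i, |v i| * (2 * |u i|) ≤ ∑ i, v i ^ 2 + ∑ i, u i ^ 2 := by
    rw [← Finset.sum_add_distrib]
    refine Finset.sum_le_sum fun i _ => ?_
    nlinarith [sq_nonneg (|v i| - |u i|), sq_abs (v i), sq_abs (u i)]
  constructor
  · refine le_trans (mul_le_mul_of_nonneg_left hvar two_pos.le) (le_trans ?_ hprod)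
    rw [Finset.mul_sum]
    refine Finset.sum_le_sum fun i _ => ?_
    have := mul_le_mul_of_nonneg_left (slopeVariation_relu_le n X hX (u i) (b i)).1
      (abs_nonneg (v i))
    linarith
  · refine le_trans (add_le_add hvar hends) (le_trans ?_ hprod)
    rw [← Finset.sum_add_distrib]
    refine Finset.sum_le_sum fun i _ => ?_
    rw [← mul_add]
    exact mul_le_mul_of_nonneg_left (slopeVariation_relu_le n X hX (u i) (b i)).2
      (abs_nonneg (v i))

/-- Expansion of a linear spline in the ReLU functions of its knots. -/
theorem linear_spline_eq_sum_relu (n : ℕ) (X Y : ℕ → ℝ) (hX : ∀ k ≤ n, X k < X (k + 1))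
    (j : ℕ) (hj : j ≤ n) (t : ℝ) (h₀ : X j ≤ t) (h₁ : t ≤ X (j + 1)) :
    Y 0 + segmentSlope X Y 0 * (t - X 0) + ∑ k ∈ Finset.range n,
        (segmentSlope X Y (k + 1) - segmentSlope X Y k) * max 0 (t - X (k + 1)) =
      Y j + segmentSlope X Y j * (t - X j) := by
  have hmono (p q : ℕ) (hpq : p ≤ q) (hq : q ≤ n + 1) : X p ≤ X q := by
    induction q, hpq using Nat.le_induction with
    | base => rfl
    | succ q _ ih => exact (ih (by omega)).trans (hX q (by omega)).le
  have htrunc : ∑ k ∈ Finset.range n,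
        (segmentSlope X Y (k + 1) - segmentSlope X Y k) * max 0 (t - X (k + 1)) =
      ∑ k ∈ Finset.range j,
        (segmentSlope X Y (k + 1) - segmentSlope X Y k) * (t - X (k + 1)) := by
    rw [← Finset.sum_subset (Finset.range_subset_range.2 hj)]
    · refine Finset.sum_congr rfl fun k hk => ?_
      have := Finset.mem_range.1 hk
      rw [max_eq_right]
      linarith [hmono (k + 1) j (by omega) (by omega)]
    · intro k hk hk'
      rw [Finset.mem_range] at hk hk'
      rw [max_eq_left, mul_zero]
      linarith [hmono (j + 1) (k + 1) (by omega) (by omega)]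
  rw [htrunc]
  clear htrunc h₀ h₁
  induction j with
  | zero => simp
  | succ j ih =>
    rw [Finset.sum_range_succ, ← add_assoc, ih (by omega)]
    have hd : X (j + 1) - X j ≠ 0 := (sub_pos.2 (hX j (by omega))).ne'
    have : segmentSlope X Y j * (X (j + 1) - X j) = Y (j + 1) - Y j := div_mul_cancel₀ _ hd
    linear_combination this

/-- The linear spline through `(X k, Y k)`, `k ≤ n + 1`, is realised on `[X 0, X (n + 1)]` by a
network whose weight norm is at most any number compatible with the slope bounds. -/
theorem exists_reluNet_linear_spline (n : ℕ) (X Y : ℕ → ℝ) (hX : ∀ k ≤ n, X k < X (k + 1)) :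
    ∃ N : ℕ, n + 2 ≤ N ∧ ∃ (v u b : Fin N → ℝ) (c : ℝ),
      (∀ j ≤ n, ∀ t, X j ≤ t → t ≤ X (j + 1) →
        reluNet N v u b c t = Y j + segmentSlope X Y j * (t - X j)) ∧
      ∀ B : ℝ, 2 * slopeVariation n X Y ≤ B →
        slopeVariation n X Y + |segmentSlope X Y 0 + segmentSlope X Y n| ≤ B →
        weightNorm N v u ≤ Real.sqrt B := by
  set S := segmentSlope X Y with hS
  set d : ℕ → ℝ := fun k => S (k + 1) - S k with hd
  have hTd : slopeVariation n X Y = ∑ k ∈ Finset.range n, |d k| := rfl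
  set T := slopeVariation n X Y with hT
  have hT0 : 0 ≤ T := Finset.sum_nonneg fun _ _ => abs_nonneg _
  obtain ⟨η, hη, hmax⟩ := exists_abs_add_mul_eq_max (S 0 + S n) T hT0
  have hsum : ∑ k ∈ Finset.range n, d k = S n - S 0 := Finset.sum_range_sub S n
  set p : ℕ → ℝ := fun k => (d k - η * |d k|) / 2 with hp
  set q : ℕ → ℝ := fun k => (d k + η * |d k|) / 2 with hq
  have hqsum : ∑ k ∈ Finset.range n, q k = (S n - S 0 + η * T) / 2 := by
    rw [← Finset.sum_div, Finset.sum_add_distrib, ← Finset.mul_sum, hsum, hTd]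
  set l : ℝ := (S 0 + S n + η * T) / 2 with hl
  obtain ⟨v, u, b, hnet, hnorm⟩ := exists_balanced_reluNet (ι := Fin (n + 1) ⊕ Fin (n + 1))
    (Sum.elim (Fin.cons l fun k => p k) (Fin.cons 0 fun k => q k))
    (Sum.elim (fun _ => 1) (fun _ => -1)) (Sum.elim (fun k => X k) (fun k => X k))
    (by rintro (i | i) <;> simp)
  refine ⟨_, by simp; omega, v, u, b, Y 0 - ∑ k ∈ Finset.range n, q k * (X (k + 1) - X 0),
    fun j hj t h₀ h₁ => ?_, fun B hB₁ hB₂ => ?_⟩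
  · have ht : X 0 ≤ t := by
      refine le_trans ?_ h₀
      clear h₀ h₁
      induction j with
      | zero => rfl
      | succ j ih => exact (ih (by omega)).trans (hX j (by omega)).le
    rw [hnet, ← linear_spline_eq_sum_relu n X Y hX j hj t h₀ h₁]
    simp only [Fintype.sum_sum_type, Fin.sum_univ_succ, Sum.elim_inl, Sum.elim_inr,
      Fin.cons_zero, Fin.cons_succ, Fin.val_zero, Fin.val_succ, one_mul, zero_mul, zero_add]
    rw [Fin.sum_univ_eq_sum_range (fun k => p k * max 0 (t - X (k + 1))),
      Fin.sum_univ_eq_sum_range (fun k => q k * max 0 (-1 * (t - X (k + 1)))),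
      max_eq_right (sub_nonneg.2 ht)]
    have hunit (k : ℕ) : p k * max 0 (t - X (k + 1)) + q k * max 0 (-1 * (t - X (k + 1))) =
        (S (k + 1) - S k) * max 0 (t - X (k + 1)) + q k * (X (k + 1) - X 0) -
          q k * (t - X 0) := by
      have hpq : p k + q k = S (k + 1) - S k := by simp only [hp, hq, hd]; ring
      have hneg : max 0 (-1 * (t - X (k + 1))) = max 0 (t - X (k + 1)) - (t - X (k + 1)) := by
        rcases le_total 0 (t - X (k + 1)) with h | h
        · rw [max_eq_left (by linarith), max_eq_right h]; ring
        · rw [max_eq_right (by linarith), max_eq_left h]; ring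
      rw [hneg, ← hpq]
      ring
    have htotal := Finset.sum_congr (rfl : Finset.range n = _) fun k _ => hunit k
    rw [Finset.sum_add_distrib, Finset.sum_sub_distrib, Finset.sum_add_distrib,
      ← Finset.sum_mul, hqsum] at htotal
    rw [← hS]
    linear_combination htotal
  · rw [hnorm]
    apply Real.sqrt_le_sqrt
    simp only [Fintype.sum_sum_type, Fin.sum_univ_succ, Sum.elim_inl, Sum.elim_inr,
      Fin.cons_zero, Fin.cons_succ, abs_zero, zero_add]
    rw [Fin.sum_univ_eq_sum_range (fun k => |p k|), Fin.sum_univ_eq_sum_range (fun k => |q k|),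
      add_assoc, ← Finset.sum_add_distrib]
    have hpq : ∑ k ∈ Finset.range n, (|p k| + |q k|) = T := by
      rw [hTd]
      refine Finset.sum_congr rfl fun k _ => ?_
      rw [add_comm]
      exact abs_half_add_mul_abs (d k) η hη
    have hlabs : 2 * |l| = max 0 (|S 0 + S n| - T) := by
      rw [← hmax, hl, abs_div, abs_two]
      ring
    rw [hpq, mul_add, hlabs]
    rcases max_cases 0 (|S 0 + S n| - T) with h | h <;> linarith

/-- The infimum of the weight norm over all interpolating two-layer ReLU networks with
`N ≥ M` hidden units is attained by a network that agrees, on the interval spanned by the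
data, with the minimal-knot linear spline interpolant of the data (i.e., it connects
consecutive data points by affine segments). -/
theorem min_norm_reluNet_is_linear_spline (M : ℕ) (hM : 1 ≤ M)
    (x y : Fin M → ℝ) (hx : Function.Injective x) :
    ∃ N : ℕ, M ≤ N ∧ ∃ (v u b : Fin N → ℝ) (c : ℝ),
      (∀ i, reluNet N v u b c (x i) = y i) ∧
      weightNorm N v u =
        sInf {t : ℝ | ∃ N' : ℕ, M ≤ N' ∧ ∃ (v' u' b' : Fin N' → ℝ) (c' : ℝ),
          (∀ i, reluNet N' v' u' b' c' (x i) = y i) ∧ t = weightNorm N' v' u'} ∧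
      (∀ i j : Fin M, x i < x j → (∀ k : Fin M, ¬(x i < x k ∧ x k < x j)) →
        ∀ t : ℝ, x i ≤ t → t ≤ x j →
          reluNet N v u b c t = y i + (y j - y i) * (t - x i) / (x j - x i)) := by
  obtain rfl | ⟨n, rfl⟩ : M = 1 ∨ ∃ n, M = n + 2 := by
    rcases hM.eq_or_lt with h | h
    · exact Or.inl h.symm
    · exact Or.inr ⟨M - 2, by omega⟩
  · have hnet (i : Fin 1) : reluNet 1 (fun _ => 0) (fun _ => 0) (fun _ => 0) (y 0) (x i) = y i := by
      simp [reluNet, Subsingleton.elim i 0]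
    refine ⟨1, le_rfl, fun _ => 0, fun _ => 0, fun _ => 0, y 0, hnet, ?_, fun i j hij => ?_⟩
    · symm
      refine IsLeast.csInf_eq ⟨⟨1, le_rfl, _, _, _, _, hnet, rfl⟩, ?_⟩
      rintro _ ⟨N, -, v, u, b, c, -, rfl⟩
      simp [weightNorm]
    · exact absurd hij (by simp [Subsingleton.elim i j])
  have hmono : StrictMono (x ∘ Tuple.sort x) :=
    (Tuple.monotone_sort x).strictMono_of_injective (hx.comp (Tuple.sort x).injective)
  set σ := Tuple.sort x
  set X : ℕ → ℝ := fun k => x (σ (Fin.ofNat (n + 2) k))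
  set Y : ℕ → ℝ := fun k => y (σ (Fin.ofNat (n + 2) k))
  have hXval (a : Fin (n + 2)) : X a = x (σ a) := by simp [X]
  have hYval (a : Fin (n + 2)) : Y a = y (σ a) := by simp [Y]
  have hX (k : ℕ) (hk : k ≤ n) : X k < X (k + 1) := by
    have := @hmono ⟨k, by omega⟩ ⟨k + 1, by omega⟩ (by simp)
    simpa only [← hXval, Function.comp_apply] using this
  obtain ⟨N, hN, v, u, b, c, hspline, hmin⟩ := exists_reluNet_linear_spline n X Y hX
  have hinterp (i : Fin (n + 2)) : reluNet N v u b c (x i) = y i := by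
    obtain ⟨a, rfl⟩ := σ.surjective i
    rw [← hXval, ← hYval]
    rcases Nat.lt_or_ge n a with ha | ha
    · have ha' : (a : ℕ) = n + 1 := by omega
      have hd : X (n + 1) - X n ≠ 0 := (sub_pos.2 (hX n le_rfl)).ne'
      rw [ha', hspline n le_rfl _ (hX n le_rfl).le le_rfl, segmentSlope, div_mul_cancel₀ _ hd]
      ring
    · rw [hspline a ha _ le_rfl (hX a ha).le]
      ring
  refine ⟨N, hN, v, u, b, c, hinterp, ?_, fun i j hij hcons t h₀ h₁ => ?_⟩
  · symm
    refine IsLeast.csInf_eq ⟨⟨N, hN, v, u, b, c, hinterp, rfl⟩, ?_⟩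
    rintro _ ⟨N', -, v', u', b', c', hnet, rfl⟩
    have hY : (fun k => reluNet N' v' u' b' c' (X k)) = Y := funext fun k => hnet _
    have hbound := slope_bounds_le_sum_sq n X hX N' v' u' b' c'
    rw [hY] at hbound
    exact hmin _ hbound.1 hbound.2
  · obtain ⟨a, rfl⟩ := σ.surjective i
    obtain ⟨a', rfl⟩ := σ.surjective j
    have haa : a < a' := hmono.lt_iff_lt.1 hij
    have hsucc : (a' : ℕ) = a + 1 := by
      by_contra hne
      have hlt : (a : ℕ) + 1 < a' := by
        have : (a : ℕ) < a' := haa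
        omega
      refine hcons (σ ⟨a + 1, by omega⟩) ⟨hmono ?_, hmono ?_⟩
      · exact Nat.lt_succ_self (a : ℕ)
      · exact hlt
    rw [← hXval] at h₀
    rw [← hXval, hsucc] at h₁
    rw [← hXval, ← hXval, ← hYval, ← hYval, hsucc, hspline a (by omega) t h₀ h₁, segmentSlope]
    ring
end

section
/- Fix h > 0, points x₁ < … < x_n in ℝ, and labels y ∈ {−1,+1}ⁿ. Suppose y_j ≠ y_{j+1} and y_k ≠ y_{k+1} for two indices j, k, with x_{j+1} − x_j ≤ x_{k+1} − x_k. Let m_j = (x_j + x_{j+1})/2 and m_k = (x_k + x_{k+1})/2. Then score_H(m_j) ≥ score_H(m_k), where for x_i < u < x_{i+1} the score is score_H(u) := min over ε ∈ {−1,+1} of ỹ_εᵀ K̃_u⁻¹ ỹ_ε, with K̃_u the (n+1)×(n+1) Laplace kernel matrix of the points {x₁,…,x_n, u} and ỹ_ε the label vector extending y by assigning ε to u. In other words, among oppositely labeled consecutive pairs, the midpoint of the shorter gap has the larger score. -/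
open Matrix

/-- The Laplace-kernel matrix of a tuple of points in ℝ. -/
noncomputable def kerMat {n : ℕ} (h : ℝ) (pts : Fin n → ℝ) : Matrix (Fin n) (Fin n) ℝ :=
  Matrix.of fun i j => Real.exp (-|pts i - pts j| / h)

/-- The squared RKHS norm `yᵀ K⁻¹ y` of the minimum-norm Laplace-kernel interpolant. -/
noncomputable def qf {n : ℕ} (h : ℝ) (pts y : Fin n → ℝ) : ℝ :=
  y ⬝ᵥ (kerMat h pts)⁻¹.mulVec y

/-- The maximin score of an unlabeled point `u` given labeled points `(x, y)`:
the minimum over the two candidate labels `ε = ±1` of the squared RKHS norm of the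
minimum-norm Laplace-kernel interpolant of the augmented labeled set. -/
noncomputable def scoreH {n : ℕ} (h : ℝ) (x y : Fin n → ℝ) (u : ℝ) : ℝ :=
  min (qf h (Fin.snoc x u) (Fin.snoc y 1)) (qf h (Fin.snoc x u) (Fin.snoc y (-1)))

/-- The vector of Laplace-kernel values between a tuple of points and a point `u`. -/
noncomputable def kerVec {n : ℕ} (h : ℝ) (pts : Fin n → ℝ) (u : ℝ) : Fin n → ℝ :=
  fun i => Real.exp (-|pts i - u| / h)

lemma kerMat_snoc_mulVec {n : ℕ} (h : ℝ) (x v : Fin n → ℝ) (u t : ℝ) :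
    (kerMat h (Fin.snoc x u : Fin (n + 1) → ℝ)).mulVec (Fin.snoc v t : Fin (n + 1) → ℝ) =
      (Fin.snoc ((kerMat h x).mulVec v + t • kerVec h x u) (kerVec h x u ⬝ᵥ v + t) :
        Fin (n + 1) → ℝ) := by
  funext i
  refine Fin.lastCases ?_ (fun i => ?_) i
  · simp [mulVec, dotProduct, Fin.sum_univ_castSucc, kerMat, kerVec, abs_sub_comm u]
  · simp [mulVec, dotProduct, Fin.sum_univ_castSucc, kerMat, kerVec, mul_comm t]

lemma kerMat_transpose {n : ℕ} (h : ℝ) (x : Fin n → ℝ) : (kerMat h x)ᵀ = kerMat h x := by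
  ext i j
  simp [kerMat, abs_sub_comm (x j)]

lemma snoc_dotProduct_snoc {n : ℕ} (v w : Fin n → ℝ) (s t : ℝ) :
    (Fin.snoc v s : Fin (n + 1) → ℝ) ⬝ᵥ (Fin.snoc w t : Fin (n + 1) → ℝ) = v ⬝ᵥ w + s * t := by
  simp [dotProduct, Fin.sum_univ_castSucc]

/-- If `K c = b` with `b` the kernel vector of `u`, then `b ⬝ v = c ⬝ K v`. -/
lemma kerVec_dotProduct {n : ℕ} {h : ℝ} {x c : Fin n → ℝ} {u : ℝ}
    (hc : (kerMat h x).mulVec c = kerVec h x u) (v : Fin n → ℝ) :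
    kerVec h x u ⬝ᵥ v = c ⬝ᵥ (kerMat h x).mulVec v := by
  rw [← hc, dotProduct_mulVec, ← mulVec_transpose, kerMat_transpose]

lemma isUnit_kerMat_snoc {n : ℕ} {h : ℝ} {x c : Fin n → ℝ} {u : ℝ}
    (hK : IsUnit (kerMat h x))
    (hc : (kerMat h x).mulVec c = kerVec h x u) (hs : kerVec h x u ⬝ᵥ c ≠ 1) :
    IsUnit (kerMat h (Fin.snoc x u : Fin (n + 1) → ℝ)) := by
  rw [← mulVec_injective_iff_isUnit] at hK ⊢
  refine (injective_iff_map_eq_zero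
    (kerMat h (Fin.snoc x u : Fin (n + 1) → ℝ)).mulVecLin).2 fun w hw => ?_
  rw [mulVecLin_apply, ← Fin.snoc_init_self w, kerMat_snoc_mulVec] at hw
  set v : Fin n → ℝ := Fin.init w
  set t : ℝ := w (Fin.last n)
  have h1 : (kerMat h x).mulVec v + t • kerVec h x u = 0 := by
    funext i
    simpa using congrFun hw i.castSucc
  have h2 : kerVec h x u ⬝ᵥ v + t = 0 := by simpa using congrFun hw (Fin.last n)
  have h3 : (kerMat h x).mulVec v = -(t • kerVec h x u) := eq_neg_of_add_eq_zero_left h1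
  have ht : t = 0 := by
    rw [kerVec_dotProduct hc, h3, dotProduct_neg, dotProduct_smul, dotProduct_comm,
      smul_eq_mul] at h2
    have : t * (1 - kerVec h x u ⬝ᵥ c) = 0 := by linarith
    exact (mul_eq_zero.1 this).resolve_right (sub_ne_zero.2 hs.symm)
  have hv : v = 0 := hK (by simpa [ht] using h3)
  rw [← Fin.snoc_init_self w]
  change (Fin.snoc v t : Fin (n + 1) → ℝ) = 0
  funext i
  refine Fin.lastCases ?_ (fun i => ?_) i <;> simp [ht, hv]

lemma isUnit_kerMat {h : ℝ} (hh : 0 < h) {n : ℕ} (x : Fin n → ℝ) (hx : StrictMono x) :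
    IsUnit (kerMat h x) := by
  induction n with
  | zero => exact isUnit_of_subsingleton _
  | succ n ih =>
    have hinit : StrictMono (Fin.init x : Fin n → ℝ) := hx.comp Fin.strictMono_castSucc
    rw [← Fin.snoc_init_self x]
    rcases n with _ | m
    · exact isUnit_kerMat_snoc (c := 0) (ih _ hinit) (Subsingleton.elim _ _) (by simp)
    · set z : Fin (m + 1) → ℝ := Fin.init x
      set u : ℝ := x (Fin.last (m + 1))
      have hzu : z (Fin.last m) < u := hx (Fin.castSucc_lt_last _)
      set r : ℝ := Real.exp (-(u - z (Fin.last m)) / h) with hr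
      have hr1 : r < 1 := by
        rw [hr, Real.exp_lt_one_iff]
        exact div_neg_of_neg_of_pos (by linarith) hh
      have hr0 : 0 < r := Real.exp_pos _
      refine isUnit_kerMat_snoc (c := Pi.single (Fin.last m) r) (ih _ hinit) ?_ ?_
      · funext i
        have hi : z i ≤ z (Fin.last m) := hinit.monotone (Fin.le_last i)
        simp only [mulVec_single, kerMat, kerVec, Pi.smul_apply, Matrix.col_apply, of_apply,
          MulOpposite.smul_eq_mul_unop, MulOpposite.unop_op, hr]
        rw [← Real.exp_add, abs_of_nonpos (by linarith), abs_of_nonpos (by linarith)]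
        congr 1
        ring
      · have : kerVec h z u (Fin.last m) = r := by
          rw [kerVec, abs_of_nonpos (by linarith), hr]
          congr 2
          ring
        rw [dotProduct_single, this]
        nlinarith

/-- Schur-complement formula for the squared norm after adding the point `u` with label `e`. -/
lemma qf_snoc {n : ℕ} {h : ℝ} {x c : Fin n → ℝ} {u : ℝ} (hK : IsUnit (kerMat h x))
    (hc : (kerMat h x).mulVec c = kerVec h x u) (hs : kerVec h x u ⬝ᵥ c ≠ 1)
    (y : Fin n → ℝ) (e : ℝ) :
    qf h (Fin.snoc x u : Fin (n + 1) → ℝ) (Fin.snoc y e : Fin (n + 1) → ℝ) =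
      qf h x y + (e - c ⬝ᵥ y) ^ 2 / (1 - kerVec h x u ⬝ᵥ c) := by
  have hs' : 1 - kerVec h x u ⬝ᵥ c ≠ 0 := sub_ne_zero.2 hs.symm
  have hU := isUnit_kerMat_snoc hK hc hs
  set z : Fin n → ℝ := (kerMat h x)⁻¹.mulVec y with hz
  have hKz : (kerMat h x).mulVec z = y := by
    rw [hz, mulVec_mulVec, mul_nonsing_inv _ ((isUnit_iff_isUnit_det _).1 hK), one_mulVec]
  set t : ℝ := (e - c ⬝ᵥ y) / (1 - kerVec h x u ⬝ᵥ c) with ht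
  have htm : t * (1 - kerVec h x u ⬝ᵥ c) = e - c ⬝ᵥ y := div_mul_cancel₀ _ hs'
  have hsol : (kerMat h (Fin.snoc x u : Fin (n + 1) → ℝ)).mulVec
      (Fin.snoc (z - t • c) t : Fin (n + 1) → ℝ) = (Fin.snoc y e : Fin (n + 1) → ℝ) := by
    rw [kerMat_snoc_mulVec, mulVec_sub, mulVec_smul, hc, hKz, sub_add_cancel, dotProduct_sub,
      kerVec_dotProduct hc z, hKz, dotProduct_smul, smul_eq_mul]
    congr 1
    linarith
  have hinv : (kerMat h (Fin.snoc x u : Fin (n + 1) → ℝ))⁻¹.mulVec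
      (Fin.snoc y e : Fin (n + 1) → ℝ) = (Fin.snoc (z - t • c) t : Fin (n + 1) → ℝ) := by
    rw [← hsol, mulVec_mulVec, nonsing_inv_mul _ ((isUnit_iff_isUnit_det _).1 hU), one_mulVec]
  rw [qf, hinv, snoc_dotProduct_snoc, dotProduct_sub, dotProduct_smul, dotProduct_comm y c,
    smul_eq_mul, qf, ← hz, sq, mul_div_assoc, ← ht]
  ring

/-- The score of the midpoint of an oppositely labeled gap of length `d`, in terms of
`q = exp (-d / h)`. -/
lemma scoreH_midpoint {n : ℕ} {h : ℝ} (hh : 0 < h) {x y : Fin n → ℝ} (hx : StrictMono x)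
    {p q : Fin n} (hpq : (p : ℕ) + 1 = q) (hy : y p + y q = 0) :
    scoreH h x y ((x p + x q) / 2) =
      qf h x y + (1 + Real.exp (-(x q - x p) / h)) / (1 - Real.exp (-(x q - x p) / h)) := by
  have hlt : x p < x q := hx (Fin.lt_def.2 (by omega))
  set u : ℝ := (x p + x q) / 2 with hu
  set a : ℝ := Real.exp (-(x q - x p) / 2 / h) with ha
  have ha0 : 0 < a := Real.exp_pos _
  have ha1 : a < 1 := by
    rw [ha, Real.exp_lt_one_iff]
    exact div_neg_of_neg_of_pos (by linarith) hh
  have haa : Real.exp (-(x q - x p) / h) = a * a := by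
    rw [ha, ← Real.exp_add]
    congr 1
    ring
  have hden : 1 + a * a ≠ 0 := by positivity
  set α : ℝ := a / (1 + a * a) with hα
  have hαm : α * (1 + a * a) = a := div_mul_cancel₀ _ hden
  set c : Fin n → ℝ := Pi.single p α + Pi.single q α with hcdef
  have hc : (kerMat h x).mulVec c = kerVec h x u := by
    funext i
    simp only [hcdef, mulVec_add, mulVec_single, kerMat, kerVec, Pi.add_apply, Pi.smul_apply,
      Matrix.col_apply, of_apply, MulOpposite.smul_eq_mul_unop, MulOpposite.unop_op]
    rcases le_or_gt i p with hi | hi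
    · have hip : x i ≤ x p := hx.monotone hi
      rw [abs_of_nonpos (by linarith), abs_of_nonpos (by linarith), abs_of_nonpos (by linarith)]
      have e1 : Real.exp (-(-(x i - x q)) / h) = Real.exp (-(-(x i - x p)) / h) * (a * a) := by
        rw [← haa, ← Real.exp_add]
        congr 1
        ring
      have e2 : Real.exp (-(-(x i - u)) / h) = Real.exp (-(-(x i - x p)) / h) * a := by
        rw [ha, ← Real.exp_add, hu]
        congr 1
        ring
      rw [e1, e2]
      linear_combination Real.exp (-(-(x i - x p)) / h) * hαm
    · have hiq : x q ≤ x i := hx.monotone (Fin.le_def.2 (by have := Fin.lt_def.1 hi; omega))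
      rw [abs_of_nonneg (by linarith), abs_of_nonneg (by linarith), abs_of_nonneg (by linarith)]
      have e1 : Real.exp (-(x i - x p) / h) = Real.exp (-(x i - x q) / h) * (a * a) := by
        rw [← haa, ← Real.exp_add]
        congr 1
        ring
      have e2 : Real.exp (-(x i - u) / h) = Real.exp (-(x i - x q) / h) * a := by
        rw [ha, ← Real.exp_add, hu]
        congr 1
        ring
      rw [e1, e2]
      linear_combination Real.exp (-(x i - x q) / h) * hαm
  have hbp : kerVec h x u p = a := by
    rw [kerVec, abs_of_nonpos (by linarith), ha, hu]
    congr 1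
    ring
  have hbq : kerVec h x u q = a := by
    rw [kerVec, abs_of_nonneg (by linarith), ha, hu]
    congr 1
    ring
  have hbc : 1 - kerVec h x u ⬝ᵥ c = (1 - a * a) / (1 + a * a) := by
    rw [hcdef, dotProduct_add, dotProduct_single, dotProduct_single, hbp, hbq, hα]
    field_simp
    ring
  have hpos : 0 < (1 - a * a) / (1 + a * a) := div_pos (by nlinarith) (by positivity)
  have hcy : c ⬝ᵥ y = 0 := by
    rw [hcdef, add_dotProduct, single_dotProduct, single_dotProduct, ← mul_add, hy, mul_zero]
  have key := qf_snoc (isUnit_kerMat hh x hx) hc (by intro hs; rw [hs] at hbc; linarith) y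
  rw [scoreH, key, key, hcy, hbc, haa]
  norm_num

/-- Among oppositely labeled consecutive pairs, the midpoint of the shorter gap has the
larger score. -/
theorem laplace_score_shorter_gap_midpoint_larger (n : ℕ) (h : ℝ) (hh : 0 < h)
    (x y : Fin n → ℝ) (hx : StrictMono x) (hy : ∀ i, y i = 1 ∨ y i = -1)
    (j k : ℕ) (hj : j + 1 < n) (hk : k + 1 < n)
    (hjy : y ⟨j, by omega⟩ ≠ y ⟨j + 1, hj⟩)
    (hky : y ⟨k, by omega⟩ ≠ y ⟨k + 1, hk⟩)
    (hgap : x ⟨j + 1, hj⟩ - x ⟨j, by omega⟩ ≤ x ⟨k + 1, hk⟩ - x ⟨k, by omega⟩) :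
    scoreH h x y ((x ⟨k, by omega⟩ + x ⟨k + 1, hk⟩) / 2)
      ≤ scoreH h x y ((x ⟨j, by omega⟩ + x ⟨j + 1, hj⟩) / 2) := by
  have opp : ∀ p q, y p ≠ y q → y p + y q = 0 := by
    intro p q hne
    rcases hy p with hp | hp <;> rcases hy q with hq | hq <;> simp_all
  rw [scoreH_midpoint hh hx rfl (opp _ _ hky), scoreH_midpoint hh hx rfl (opp _ _ hjy)]
  have hlt : x ⟨j, by omega⟩ < x ⟨j + 1, hj⟩ := hx (Fin.lt_def.2 (Nat.lt_succ_self j))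
  have hexp : Real.exp (-(x ⟨k + 1, hk⟩ - x ⟨k, by omega⟩) / h) ≤
      Real.exp (-(x ⟨j + 1, hj⟩ - x ⟨j, by omega⟩) / h) := by
    gcongr
  have hone : Real.exp (-(x ⟨j + 1, hj⟩ - x ⟨j, by omega⟩) / h) < 1 := by
    rw [Real.exp_lt_one_iff]
    exact div_neg_of_neg_of_pos (by linarith) hh
  gcongr
end
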